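/- (Convergence of asynchronous power iteration.) Fix 0 ≤ ρ < 1. Let (N_t)_{t≥0} be a sequence of symmetric matrices in ℝ^{k×k}, (u_t)_{t≥0} a sequence of unit vectors in ℝ^k, and (λ_t)_{t≥0} positive reals such that for every t: N_t u_t = λ_t u_t, and ‖N_t w‖ ≤ ρ² λ_t ‖w‖ for every w orthogonal to u_t (uniform spectral gap). Let (p_t)_{t≥0} be unit vectors with N_t p_{t−1} ≠ 0 and p_t = N_t p_{t−1} / ‖N_t p_{t−1}‖ for all t ≥ 1. Assume: (i) ⟨u_{t−1}, u_t⟩ > 0 for all t and tan∠(u_{t−1}, u_t) → 0 (vanishing drift); (ii) ⟨p_t, u_t⟩ > 0 for all t; (iii) liminf_{t→∞} tan∠(p_t, u_t) < ∞. Then lim_{t→∞} ⟨p_t, u_t⟩ = 1. -/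

import Mathlib

open Matrix Filter

/-- Euclidean norm of a vector in ℝ^k. -/
noncomputable def euclNorm {k : ℕ} (u : Fin k → ℝ) : ℝ := Real.sqrt (∑ i, u i ^ 2)

/-- Tangent of the acute angle between `p` and the line spanned by the unit vector `u`:
`‖p − ⟨p,u⟩u‖ / |⟨p,u⟩|`. -/
noncomputable def tanAngle {k : ℕ} (p u : Fin k → ℝ) : ℝ :=
  euclNorm (p - (p ⬝ᵥ u) • u) / |p ⬝ᵥ u|

section InnerProductSpace

open scoped RealInnerProductSpace

variable {E : Type*} [NormedAddCommGroup E] [InnerProductSpace ℝ E]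

/-- The square of the part of `p` orthogonal to a unit vector `u`. -/
theorem norm_sub_inner_smul_sq (p : E) {u : E} (hu : ‖u‖ = 1) :
    ‖p - ⟪p, u⟫ • u‖ ^ 2 = ‖p‖ ^ 2 - ⟪p, u⟫ ^ 2 := by
  rw [norm_sub_sq_real, real_inner_smul_right, norm_smul, hu, mul_one, Real.norm_eq_abs, sq_abs]
  ring

theorem norm_sub_inner_smul_le (p : E) {u : E} (hu : ‖u‖ = 1) :
    ‖p - ⟪p, u⟫ • u‖ ≤ ‖p‖ := by
  refine le_of_sq_le_sq ?_ (norm_nonneg p)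
  rw [norm_sub_inner_smul_sq p hu]
  nlinarith [sq_nonneg ⟪p, u⟫]

/-- An approximate addition formula for tangents: `T` is the tangent between `p` and `u`,
`d` the one between `u` and `v`. -/
theorem norm_sub_inner_smul_mul_le {p u v : E} {T d : ℝ} (hu : ‖u‖ = 1) (hv : ‖v‖ = 1)
    (huv : 0 < ⟪u, v⟫) (hpu : 0 < ⟪p, u⟫) (hT : ‖p - ⟪p, u⟫ • u‖ = T * ⟪p, u⟫)
    (hd : ‖u - ⟪u, v⟫ • v‖ = d * ⟪u, v⟫) (hTd : T * d ≤ 1) :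
    ‖p - ⟪p, v⟫ • v‖ * (1 - T * d) ≤ ((1 + d) * T + d) * ⟪p, v⟫ := by
  set a := ⟪p, u⟫ with ha
  set c := ⟪u, v⟫ with hc
  set x := p - a • u with hx
  have hT0 : 0 ≤ T := nonneg_of_mul_nonneg_left (hT ▸ norm_nonneg _) hpu
  have hd0 : 0 ≤ d := nonneg_of_mul_nonneg_left (hd ▸ norm_nonneg _) huv
  have hcd : (d * c) ^ 2 = 1 - c ^ 2 := by
    rw [← hd, hc, norm_sub_inner_smul_sq u hv, hu, one_pow]
  have hxu : ⟪x, u⟫ = 0 := by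
    rw [hx, inner_sub_left, real_inner_smul_left, real_inner_self_eq_norm_sq, hu, ← ha]
    ring
  have hvu : ‖v - c • u‖ = d * c := by
    rw [← sq_eq_sq₀ (norm_nonneg _) (by positivity), hcd, hc, real_inner_comm,
      norm_sub_inner_smul_sq v hu, hv, one_pow]
  have hxv : |⟪x, v⟫| ≤ T * a * (d * c) := by
    have h := abs_real_inner_le_norm x (v - c • u)
    rwa [inner_sub_right, real_inner_smul_right, hxu, mul_zero, sub_zero, hT, hvu] at h
  have hp : p = a • u + x := by rw [hx]; abel
  have hpv : ⟪p, v⟫ = a * c + ⟪x, v⟫ := by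
    rw [hp, inner_add_left, real_inner_smul_left]
  have hlow : a * c * (1 - T * d) ≤ ⟪p, v⟫ := by
    rw [hpv]
    linarith [neg_abs_le ⟪x, v⟫]
  have hup : ‖p - ⟪p, v⟫ • v‖ ≤ a * (d * c + T) := by
    have hsplit : p - ⟪p, v⟫ • v = a • (u - c • v) + (x - ⟪x, v⟫ • v) := by
      rw [hpv, hx]
      module
    calc ‖p - ⟪p, v⟫ • v‖ ≤ ‖a • (u - c • v)‖ + ‖x - ⟪x, v⟫ • v‖ := by
          rw [hsplit]; exact norm_add_le _ _
      _ ≤ a * (d * c) + T * a := by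
          refine add_le_add ?_ (hT ▸ norm_sub_inner_smul_le x hv)
          rw [norm_smul, hd, Real.norm_of_nonneg hpu.le]
      _ = a * (d * c + T) := by ring
  have hc1 : 1 ≤ (1 + d) * c := by
    refine one_le_sq_iff₀ (by positivity) |>.1 ?_
    nlinarith [mul_nonneg hd0 (sq_nonneg c)]
  calc ‖p - ⟪p, v⟫ • v‖ * (1 - T * d)
      ≤ a * (d * c + T) * (1 - T * d) := by gcongr
    _ ≤ a * (((1 + d) * T + d) * c) * (1 - T * d) := by
        gcongr
        nlinarith [mul_le_mul_of_nonneg_left hc1 hT0]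
    _ = ((1 + d) * T + d) * (a * c * (1 - T * d)) := by ring
    _ ≤ ((1 + d) * T + d) * ⟪p, v⟫ := by gcongr

end InnerProductSpace

section EuclideanNorm

variable {k : ℕ}

theorem euclNorm_eq_norm_toLp (x : Fin k → ℝ) : euclNorm x = ‖WithLp.toLp 2 x‖ := by
  simp [euclNorm, EuclideanSpace.norm_eq]

theorem dotProduct_eq_inner_toLp (x y : Fin k → ℝ) :
    x ⬝ᵥ y = inner ℝ (WithLp.toLp 2 x) (WithLp.toLp 2 y) := by
  simp [dotProduct, PiLp.inner_apply, mul_comm]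

theorem euclNorm_nonneg (x : Fin k → ℝ) : 0 ≤ euclNorm x := Real.sqrt_nonneg _

theorem euclNorm_smul (a : ℝ) (x : Fin k → ℝ) : euclNorm (a • x) = |a| * euclNorm x := by
  simp only [euclNorm_eq_norm_toLp, WithLp.toLp_smul, norm_smul, Real.norm_eq_abs]

theorem tanAngle_nonneg (p u : Fin k → ℝ) : 0 ≤ tanAngle p u :=
  div_nonneg (euclNorm_nonneg _) (abs_nonneg _)

theorem euclNorm_eq_tanAngle_mul {p u : Fin k → ℝ} (h : 0 < p ⬝ᵥ u) :
    euclNorm (p - (p ⬝ᵥ u) • u) = tanAngle p u * (p ⬝ᵥ u) := by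
  rw [tanAngle, abs_of_pos h, div_mul_cancel₀ _ h.ne']

theorem tanAngle_smul {a : ℝ} (ha : a ≠ 0) (p u : Fin k → ℝ) :
    tanAngle (a • p) u = tanAngle p u := by
  rw [tanAngle, tanAngle, smul_dotProduct, smul_eq_mul, mul_smul, ← smul_sub, euclNorm_smul,
    abs_mul, mul_div_mul_left _ _ (abs_ne_zero.2 ha)]

theorem tanAngle_approx_add_le {p u v : Fin k → ℝ} (hu : euclNorm u = 1) (hv : euclNorm v = 1)
    (huv : 0 < u ⬝ᵥ v) (hpu : 0 < p ⬝ᵥ u) (hpv : 0 < p ⬝ᵥ v)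
    (h : tanAngle p u * tanAngle u v ≤ 1) :
    tanAngle p v * (1 - tanAngle p u * tanAngle u v) ≤
      (1 + tanAngle u v) * tanAngle p u + tanAngle u v := by
  have hT := euclNorm_eq_tanAngle_mul hpu
  have hd := euclNorm_eq_tanAngle_mul huv
  have hS := euclNorm_eq_tanAngle_mul hpv
  simp only [euclNorm_eq_norm_toLp, dotProduct_eq_inner_toLp, WithLp.toLp_sub,
    WithLp.toLp_smul] at hu hv huv hpu hpv hT hd hS
  have key := norm_sub_inner_smul_mul_le hu hv huv hpu hT hd h
  rw [hS, mul_right_comm] at key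
  exact le_of_mul_le_mul_right key hpv

/-- The cosine is determined by the tangent. -/
theorem dotProduct_eq_inv_sqrt {p u : Fin k → ℝ} (hp : euclNorm p = 1) (hu : euclNorm u = 1)
    (hpu : 0 < p ⬝ᵥ u) : p ⬝ᵥ u = (Real.sqrt (1 + tanAngle p u ^ 2))⁻¹ := by
  have hT := euclNorm_eq_tanAngle_mul hpu
  have hsq : euclNorm (p - (p ⬝ᵥ u) • u) ^ 2 = 1 - (p ⬝ᵥ u) ^ 2 := by
    simp only [euclNorm_eq_norm_toLp, dotProduct_eq_inner_toLp, WithLp.toLp_sub,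
      WithLp.toLp_smul] at hp hu ⊢
    rw [norm_sub_inner_smul_sq _ hu, hp, one_pow]
  rw [hT] at hsq
  rw [← Real.sqrt_inv, eq_comm, Real.sqrt_eq_iff_mul_self_eq (by positivity) hpu.le]
  field_simp
  linarith

theorem dotProduct_mulVec_eigenvector {A : Matrix (Fin k) (Fin k) ℝ} (hA : A.IsSymm)
    {v : Fin k → ℝ} {l : ℝ} (hv : A *ᵥ v = l • v) (p : Fin k → ℝ) :
    (A *ᵥ p) ⬝ᵥ v = l * (p ⬝ᵥ v) := by
  rw [dotProduct_comm, dotProduct_mulVec, ← mulVec_transpose, hA.eq, hv, smul_dotProduct,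
    smul_eq_mul, dotProduct_comm]

theorem dotProduct_self_of_euclNorm_eq_one {v : Fin k → ℝ} (hv : euclNorm v = 1) :
    v ⬝ᵥ v = 1 := by
  rw [euclNorm_eq_norm_toLp] at hv
  rw [dotProduct_eq_inner_toLp, real_inner_self_eq_norm_sq, hv, one_pow]

/-- One power-iteration step contracts the tangent by the spectral gap. -/
theorem tanAngle_mulVec_le {A : Matrix (Fin k) (Fin k) ℝ} (hA : A.IsSymm) {v : Fin k → ℝ}
    {l q : ℝ} (hl : 0 < l) (hv1 : euclNorm v = 1) (hv : A *ᵥ v = l • v)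
    (hgap : ∀ w : Fin k → ℝ, w ⬝ᵥ v = 0 → euclNorm (A *ᵥ w) ≤ q * l * euclNorm w)
    (p : Fin k → ℝ) : tanAngle (A *ᵥ p) v ≤ q * tanAngle p v := by
  have hw := hgap (p - (p ⬝ᵥ v) • v) (by
    rw [sub_dotProduct, smul_dotProduct, dotProduct_self_of_euclNorm_eq_one hv1]; simp)
  have hAp : A *ᵥ (p - (p ⬝ᵥ v) • v) = A *ᵥ p - (l * (p ⬝ᵥ v)) • v := by
    rw [mulVec_sub, mulVec_smul, hv, smul_smul, mul_comm]
  rw [hAp] at hw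
  rw [tanAngle, tanAngle, dotProduct_mulVec_eigenvector hA hv, abs_mul, abs_of_pos hl]
  calc _ ≤ q * l * euclNorm (p - (p ⬝ᵥ v) • v) / (l * |p ⬝ᵥ v|) := by gcongr
    _ = q * (euclNorm (p - (p ⬝ᵥ v) • v) / |p ⬝ᵥ v|) := by
      rw [mul_comm q l, mul_assoc, mul_div_mul_left _ _ hl.ne', mul_div_assoc]

end EuclideanNorm

/-- A nonnegative sequence contracting up to a vanishing perturbation tends to zero. -/
theorem tendsto_zero_of_eventually_le_mul_add {T e : ℕ → ℝ} {r : ℝ} (hr0 : 0 ≤ r) (hr1 : r < 1)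
    (hT : ∀ t, 0 ≤ T t) (he : Tendsto e atTop (nhds 0))
    (h : ∀ᶠ t in atTop, T (t + 1) ≤ r * T t + e t) : Tendsto T atTop (nhds 0) := by
  rw [Metric.tendsto_atTop]
  intro ε hε
  have hsmall : ∀ᶠ t in atTop, e t < (1 - r) * (ε / 2) :=
    he.eventually_lt_const (mul_pos (by linarith) (by linarith))
  obtain ⟨n, hn⟩ := eventually_atTop.1 (h.and hsmall)
  have hbound : ∀ m, T (n + m) ≤ r ^ m * T n + ε / 2 := by
    intro m
    induction m with
    | zero => simpa using (half_pos hε).le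
    | succ m ih =>
      obtain ⟨h1, h2⟩ := hn (n + m) (by omega)
      have := mul_le_mul_of_nonneg_left ih hr0
      rw [← add_assoc, pow_succ]
      linarith
  have hpow : Tendsto (fun m : ℕ => r ^ m * T n) atTop (nhds 0) := by
    simpa using (tendsto_pow_atTop_nhds_zero_of_lt_one hr0 hr1).mul_const (T n)
  obtain ⟨m, hm⟩ := eventually_atTop.1 (hpow.eventually_lt_const (half_pos hε))
  refine ⟨n + m, fun t ht => ?_⟩
  have h1 := hbound (t - n)
  have h2 := hm (t - n) (by omega)
  rw [Nat.add_sub_cancel' (by omega)] at h1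
  rw [Real.dist_eq, sub_zero, abs_of_nonneg (hT t)]
  linarith

theorem tendsto_zero_of_perturbed_contraction {T d : ℕ → ℝ} {q K : ℝ} (hq0 : 0 ≤ q)
    (hq1 : q < 1) (hT : ∀ t, 0 ≤ T t) (hd0 : ∀ t, 0 ≤ d t) (hd : Tendsto d atTop (nhds 0))
    (hK : ∃ᶠ t in atTop, T t ≤ K)
    (h : ∀ t, T t * d t ≤ 1 → T (t + 1) * (1 - T t * d t) ≤ q * ((1 + d t) * T t + d t)) :
    Tendsto T atTop (nhds 0) := by
  wlog hK0 : 0 < K generalizing K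
  · exact this (K := 1) (hK.mono fun t ht => by linarith) one_pos
  obtain ⟨r, hqr, hr1⟩ := exists_between hq1
  have hr0 : 0 ≤ r := hq0.trans hqr.le
  have hdK : Tendsto (fun t => K * d t) atTop (nhds 0) := by simpa using hd.const_mul K
  have hcontr : Tendsto (fun t => q * (1 + d t) - r * (1 - K * d t)) atTop (nhds (q - r)) := by
    simpa using ((hd.const_add 1).const_mul q).sub ((hdK.const_sub 1).const_mul r)
  have hd2 : Tendsto (fun t => 2 * d t) atTop (nhds 0) := by simpa using hd.const_mul 2
  have hstep : ∀ᶠ t in atTop, T t ≤ K → T (t + 1) ≤ r * T t + 2 * d t ∧ T (t + 1) ≤ K := by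
    filter_upwards [hdK.eventually_lt_const (half_pos one_pos),
      hcontr.eventually_lt_const (sub_neg.2 hqr),
      hd2.eventually_lt_const (mul_pos (sub_pos.2 hr1) hK0)] with t h1 h2 h3 hTK
    have hTd : T t * d t ≤ K * d t := mul_le_mul_of_nonneg_right hTK (hd0 t)
    have h4 := h t (by linarith)
    have h5 : T (t + 1) * (1 - K * d t) ≤ (r * T t + 2 * d t) * (1 - K * d t) := by
      have e1 : T (t + 1) * (1 - K * d t) ≤ T (t + 1) * (1 - T t * d t) :=
        mul_le_mul_of_nonneg_left (by linarith) (hT _)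
      have e2 : q * (1 + d t) * T t ≤ r * (1 - K * d t) * T t :=
        mul_le_mul_of_nonneg_right (by linarith) (hT t)
      have e3 : q * d t ≤ 1 * d t := mul_le_mul_of_nonneg_right hq1.le (hd0 t)
      have e4 : d t * (1 / 2) ≤ d t * (1 - K * d t) :=
        mul_le_mul_of_nonneg_left (by linarith) (hd0 t)
      linarith
    have h6 := le_of_mul_le_mul_right h5 (by linarith)
    exact ⟨h6, by linarith [mul_le_mul_of_nonneg_left hTK hr0]⟩
  obtain ⟨n, hn⟩ := eventually_atTop.1 hstep
  obtain ⟨m, hnm, hm⟩ := frequently_atTop.1 hK n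
  have hbound : ∀ t ≥ m, T t ≤ K :=
    fun t ht => Nat.le_induction hm (fun s hs ih => (hn s (hnm.trans hs) ih).2) t ht
  exact tendsto_zero_of_eventually_le_mul_add hr0 hr1 hT hd2
    (eventually_atTop.2 ⟨m, fun t ht => (hn t (hnm.trans ht) (hbound t ht)).1⟩)

/-- Convergence of asynchronous power iteration: under a uniform spectral gap, vanishing
drift of the true principal eigenvectors, acute angles, and a finite liminf of the tangent
error, the power-iteration estimates align with the true eigenvectors: `⟨p_t, u_t⟩ → 1`. -/
theorem async_power_iteration_convergence {k : ℕ} (ρ : ℝ) (hρ0 : 0 ≤ ρ) (hρ1 : ρ < 1)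
    (N : ℕ → Matrix (Fin k) (Fin k) ℝ) (u : ℕ → Fin k → ℝ) (lam : ℕ → ℝ)
    (p : ℕ → Fin k → ℝ)
    (hNsymm : ∀ t, (N t).IsSymm)
    (hu : ∀ t, euclNorm (u t) = 1)
    (hlam : ∀ t, 0 < lam t)
    (heig : ∀ t, (N t).mulVec (u t) = lam t • u t)
    (hgap : ∀ t, ∀ w : Fin k → ℝ, w ⬝ᵥ u t = 0 →
      euclNorm ((N t).mulVec w) ≤ ρ ^ 2 * lam t * euclNorm w)
    (hp : ∀ t, euclNorm (p t) = 1)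
    (hpiter : ∀ t, 1 ≤ t → (N t).mulVec (p (t - 1)) ≠ 0 ∧
      p t = (euclNorm ((N t).mulVec (p (t - 1))))⁻¹ • (N t).mulVec (p (t - 1)))
    (hdriftpos : ∀ t, 1 ≤ t → 0 < u (t - 1) ⬝ᵥ u t)
    (hdrift : Tendsto (fun t => tanAngle (u (t - 1)) (u t)) atTop (nhds 0))
    (hpu : ∀ t, 0 < p t ⬝ᵥ u t)
    (hliminf : Filter.liminf (fun t => ((tanAngle (p t) (u t) : ℝ) : EReal)) atTop < ⊤) :
    Tendsto (fun t => p t ⬝ᵥ u t) atTop (nhds 1) := by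
  obtain ⟨K, hK, -⟩ := EReal.lt_iff_exists_real_btwn.1 hliminf
  have hfreq : ∃ᶠ t in atTop, tanAngle (p t) (u t) ≤ K :=
    (frequently_lt_of_liminf_lt (h := hK)).mono fun t ht => (EReal.coe_lt_coe_iff.1 ht).le
  have hT : Tendsto (fun t => tanAngle (p t) (u t)) atTop (nhds 0) := by
    refine tendsto_zero_of_perturbed_contraction (q := ρ ^ 2) (K := K)
      (d := fun t => tanAngle (u t) (u (t + 1))) (sq_nonneg ρ) (pow_lt_one₀ hρ0 hρ1 two_ne_zero)
      (fun t => tanAngle_nonneg _ _) (fun t => tanAngle_nonneg _ _)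
      ((tendsto_add_atTop_iff_nat 1).2 hdrift) hfreq fun t ht => ?_
    obtain ⟨-, hpt⟩ := hpiter (t + 1) (by omega)
    have hdr := hdriftpos (t + 1) (by omega)
    rw [Nat.add_sub_cancel] at hpt hdr
    have hpos := hpu (t + 1)
    have hinv : 0 ≤ (euclNorm (N (t + 1) *ᵥ p t))⁻¹ := inv_nonneg.2 (euclNorm_nonneg _)
    rw [hpt, smul_dotProduct, smul_eq_mul,
      dotProduct_mulVec_eigenvector (hNsymm _) (heig _)] at hpos
    have hpv : 0 < p t ⬝ᵥ u (t + 1) :=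
      pos_of_mul_pos_right (pos_of_mul_pos_right hpos hinv) (hlam _).le
    have hcontr : tanAngle (p (t + 1)) (u (t + 1)) ≤ ρ ^ 2 * tanAngle (p t) (u (t + 1)) := by
      rw [hpt, tanAngle_smul (left_ne_zero_of_mul hpos.ne')]
      exact tanAngle_mulVec_le (hNsymm _) (hlam _) (hu _) (heig _) (hgap _) _
    calc _ ≤ ρ ^ 2 * tanAngle (p t) (u (t + 1)) *
          (1 - tanAngle (p t) (u t) * tanAngle (u t) (u (t + 1))) :=
          mul_le_mul_of_nonneg_right hcontr (sub_nonneg.2 ht)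
      _ ≤ _ := by
        rw [mul_assoc]
        exact mul_le_mul_of_nonneg_left
          (tanAngle_approx_add_le (hu _) (hu _) hdr (hpu t) hpv ht) (sq_nonneg ρ)
  have hcos : Tendsto (fun x : ℝ => (Real.sqrt (1 + x ^ 2))⁻¹) (nhds 0) (nhds 1) := by
    have hcont : ContinuousAt (fun x : ℝ => (Real.sqrt (1 + x ^ 2))⁻¹) 0 :=
      ContinuousAt.inv₀ (by fun_prop) (by simp)
    simpa [ContinuousAt] using hcont
  exact (hcos.comp hT).congr fun t => (dotProduct_eq_inv_sqrt (hp t) (hu t) (hpu t)).symm
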